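/- There exists a constant C > 0 such that the following holds. Let A be an n×N random matrix with i.i.d. standard Gaussian entries, let s be a sparsity level with s/N < 1/5, set Φ = A/√n, p = s/n, and let δ = ε + (n log(N/s))^{-1/2} for any ε > 0. Let Y be a χ²₁ random variable, let t be the (1 − (s−1)/(N−1))-quantile of Y (i.e. P(Y > t) = (s−1)/(N−1)), and T = √(E(Y | Y > t)). Then with probability at least 1 − C·e^{−nε²/C}, the upper RIP constant satisfies δ_s^+(Φ) ≥ ((1 + √p·T)(1 − δ) + (1/2)p·T²)^{1/2} − 1. -/

import Mathlib

open MeasureTheory ProbabilityTheory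

/-- Law of an `n × N` matrix with i.i.d. standard Gaussian entries. -/
noncomputable def gaussianMatrixMeasure (n N : ℕ) : Measure (Fin n → Fin N → ℝ) :=
  Measure.pi fun _ => Measure.pi fun _ => gaussianReal 0 1

/-- The χ²₁ distribution: law of the square of a standard Gaussian. -/
noncomputable def chiSq1 : Measure ℝ := (gaussianReal 0 1).map (· ^ 2)

/-- The set Ψ_s of `s`-sparse unit vectors in `ℝ^N`. -/
def sparseUnitVecs (N s : ℕ) : Set (Fin N → ℝ) :=
  {x | (∑ j, x j ^ 2) = 1 ∧ (Finset.univ.filter fun j => x j ≠ 0).card ≤ s}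

/-- `‖A x‖²` for `A : ℝ^{n×N}`, `x : ℝ^N`. -/
noncomputable def normSqMulVec {n N : ℕ} (A : Fin n → Fin N → ℝ) (x : Fin N → ℝ) : ℝ :=
  ∑ i, (∑ j, A i j * x j) ^ 2

/-- The upper RIP constant `δ_s^+(A) = sup_{x ∈ Ψ_s} ‖Ax‖² − 1`. -/
noncomputable def ripPlus (n N s : ℕ) (A : Fin n → Fin N → ℝ) : ℝ :=
  sSup (normSqMulVec A '' sparseUnitVecs N s) - 1

/-- Conditional expectation `E(Y | Y > t)` for `Y ~ chiSq1`. -/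
noncomputable def condExpGt (t : ℝ) : ℝ :=
  (∫ y in Set.Ioi t, y ∂chiSq1) / (chiSq1 (Set.Ioi t)).toReal

lemma measurePreserving_swap_pi (n M : ℕ) :
    MeasurePreserving (fun (A : Fin n → Fin M → ℝ) j i => A i j)
      (gaussianMatrixMeasure n M) (gaussianMatrixMeasure M n) := by
  have key : ∀ a b : ℕ, MeasurePreserving (MeasurableEquiv.curry (Fin a) (Fin b) ℝ)
      (Measure.pi fun _ => gaussianReal 0 1) (gaussianMatrixMeasure a b) := fun a b =>
    ⟨MeasurableEquiv.measurable _, by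
      have := Measure.infinitePi_map_curry (fun (_ : Fin a) (_ : Fin b) => gaussianReal 0 1)
      simpa only [Measure.infinitePi_eq_pi, gaussianMatrixMeasure] using this⟩
  have hc := measurePreserving_piCongrLeft (α := fun _ : Fin M × Fin n => ℝ)
    (fun _ => gaussianReal 0 1) (Equiv.prodComm (Fin n) (Fin M))
  have := (key M n).comp (hc.comp (key n M).symm)
  convert! this using 1

lemma measurePreserving_isometry_pi {n : ℕ}
    (U : EuclideanSpace ℝ (Fin n) ≃ₗᵢ[ℝ] EuclideanSpace ℝ (Fin n)) :
    MeasurePreserving (fun x : Fin n → ℝ => WithLp.ofLp (U (WithLp.toLp 2 x)))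
      (Measure.pi fun _ => gaussianReal 0 1) (Measure.pi fun _ => gaussianReal 0 1) := by
  have h1 : MeasurePreserving (WithLp.toLp 2 : (Fin n → ℝ) → EuclideanSpace ℝ (Fin n))
      (Measure.pi fun _ => gaussianReal 0 1) (stdGaussian _) :=
    ⟨by fun_prop, map_pi_eq_stdGaussian⟩
  have h2 : MeasurePreserving U (stdGaussian _) (stdGaussian _) :=
    ⟨by fun_prop, stdGaussian_map U⟩
  have h3 : MeasurePreserving (WithLp.ofLp : EuclideanSpace ℝ (Fin n) → (Fin n → ℝ))
      (stdGaussian _) (Measure.pi fun _ => gaussianReal 0 1) := by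
    refine ⟨by fun_prop, ?_⟩
    rw [← map_pi_eq_stdGaussian, Measure.map_map (by fun_prop) (by fun_prop)]
    exact Measure.map_id
  exact h3.comp (h2.comp h1)

lemma measurePreserving_isometry_matrix {n : ℕ} (M : ℕ)
    (U : EuclideanSpace ℝ (Fin n) ≃ₗᵢ[ℝ] EuclideanSpace ℝ (Fin n)) :
    MeasurePreserving (fun (B : Fin n → Fin M → ℝ) i j => U (WithLp.toLp 2 fun l => B l j) i)
      (gaussianMatrixMeasure n M) (gaussianMatrixMeasure n M) := by
  have h := measurePreserving_pi (fun _ : Fin M => Measure.pi fun _ : Fin n => gaussianReal 0 1)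
    (fun _ => Measure.pi fun _ => gaussianReal 0 1) fun _ => measurePreserving_isometry_pi U
  exact (measurePreserving_swap_pi M n).comp (h.comp (measurePreserving_swap_pi n M))

lemma map_sum_mul_pi_gaussianReal {M : ℕ} (w : Fin M → ℝ) (hw : ∑ j, w j ^ 2 = 1) :
    (Measure.pi fun _ : Fin M => gaussianReal 0 1).map (fun b => ∑ j, b j * w j) =
      gaussianReal 0 1 := by
  set L := innerSL ℝ (WithLp.toLp 2 w : EuclideanSpace ℝ (Fin M))
  have hL : (fun b : Fin M → ℝ => ∑ j, b j * w j) = L ∘ WithLp.toLp 2 := by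
    ext b
    simp [L, PiLp.inner_apply]
  have hn : ‖L‖ ^ 2 = 1 := by
    rw [innerSL_apply_norm, EuclideanSpace.real_norm_sq_eq]
    exact hw
  rw [hL, ← Measure.map_map (by fun_prop) (by fun_prop), map_pi_eq_stdGaussian,
    IsGaussian.map_eq_gaussianReal, integral_strongDual_stdGaussian, variance_dual_stdGaussian, hn]
  simp

lemma measure_pi_sum_le {E : Type*} [MeasurableSpace E] (μ : Measure E) [IsProbabilityMeasure μ]
    {f : E → ℝ} (hf : Measurable f) (hf0 : ∀ x, 0 ≤ f x) {l b : ℝ} (hl : 0 ≤ l)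
    (hb : ∫ x, Real.exp (-l * f x) ∂μ ≤ Real.exp (-b)) (m : ℕ) (a : ℝ) :
    (Measure.pi fun _ : Fin m => μ) {x | ∑ i, f (x i) ≤ a} ≤
      ENNReal.ofReal (Real.exp (l * a - m * b)) := by
  have hint : Integrable (fun x : Fin m → E => Real.exp (-l * ∑ i, f (x i)))
      (Measure.pi fun _ => μ) := by
    refine Integrable.of_bound (C := 1) (Measurable.aestronglyMeasurable (by fun_prop))
      (ae_of_all _ fun x => ?_)
    rw [Real.norm_eq_abs, Real.abs_exp, Real.exp_le_one_iff]
    nlinarith [Finset.sum_nonneg fun i (_ : i ∈ Finset.univ) => hf0 (x i)]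
  have h := measure_le_le_exp_mul_mgf (μ := Measure.pi fun _ : Fin m => μ) a
    (neg_nonpos.2 hl) hint
  have hm : mgf (fun x : Fin m → E => ∑ i, f (x i)) (Measure.pi fun _ => μ) (-l) ≤
      Real.exp (-(m * b)) := by
    have : ∀ x : Fin m → E, Real.exp (-l * ∑ i, f (x i)) = ∏ i, Real.exp (-l * f (x i)) := by
      intro x
      rw [Finset.mul_sum, Real.exp_sum]
    simp only [mgf, this]
    rw [integral_fintype_prod_eq_pow (fun x => Real.exp (-l * f x)), Fintype.card_fin,
      show -(m * b) = m * (-b) by ring, Real.exp_nat_mul]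
    exact pow_le_pow_left₀ (integral_nonneg fun x => (Real.exp_pos _).le) hb m
  rw [← ofReal_measureReal]
  refine ENNReal.ofReal_le_ofReal (h.trans ?_)
  rw [sub_eq_add_neg, Real.exp_add, neg_neg]
  gcongr

lemma integral_exp_neg_mul_sq_gaussianReal_le {l : ℝ} (hl : 0 ≤ l) :
    ∫ x, Real.exp (-l * x ^ 2) ∂(gaussianReal 0 1) ≤ Real.exp (-(l - l ^ 2)) := by
  rw [integral_gaussianReal_eq_integral_smul one_ne_zero]
  have h1 : ∀ x : ℝ, gaussianPDFReal 0 1 x • Real.exp (-l * x ^ 2) =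
      (√(2 * Real.pi))⁻¹ * Real.exp (-(l + 1 / 2) * x ^ 2) := by
    intro x
    simp only [gaussianPDFReal, smul_eq_mul, NNReal.coe_one, mul_one, sub_zero]
    rw [mul_assoc, ← Real.exp_add]
    ring_nf
  simp only [h1]
  rw [integral_const_mul, integral_gaussian, ← Real.sqrt_inv, ← Real.sqrt_mul (by positivity)]
  have h2 : (2 * Real.pi)⁻¹ * (Real.pi / (l + 1 / 2)) = (1 + 2 * l)⁻¹ := by
    have := Real.pi_pos
    field_simp
    ring
  rw [h2]
  refine Real.sqrt_le_iff.2 ⟨(Real.exp_pos _).le, ?_⟩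
  rw [← Real.exp_nat_mul, inv_le_comm₀ (by positivity) (Real.exp_pos _), ← Real.exp_neg]
  have h3 : -(((2 : ℕ) : ℝ) * -(l - l ^ 2)) = 2 * l - 2 * l ^ 2 := by push_cast; ring
  rw [h3]
  by_cases h : l ≤ 1
  · have h4 := Real.add_one_le_exp (-(2 * l - 2 * l ^ 2))
    have h5 : 2 * l - 2 * l ^ 2 ≤ Real.log (1 + 2 * l) := by
      have := Real.le_log_one_add_of_nonneg (x := 2 * l) (by positivity)
      refine le_trans ?_ this
      rw [le_div_iff₀ (by positivity)]
      nlinarith [pow_nonneg hl 3]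
    calc _ ≤ Real.exp (Real.log (1 + 2 * l)) := Real.exp_le_exp.2 h5
      _ = _ := Real.exp_log (by positivity)
  · calc _ ≤ Real.exp 0 := Real.exp_le_exp.2 (by nlinarith)
      _ ≤ _ := by rw [Real.exp_zero]; linarith

lemma gaussian_pi_sum_sq_le {m : ℕ} {n η : ℝ} (hη : 0 ≤ η) (hm : m ≤ n) :
    (Measure.pi fun _ : Fin m => gaussianReal 0 1) {x | ∑ i, x i ^ 2 ≤ m - n * η} ≤
      ENNReal.ofReal (Real.exp (-(n * η ^ 2 / 4))) := by
  refine (measure_pi_sum_le (gaussianReal 0 1) (f := fun x => x ^ 2) (by fun_prop)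
    (fun x => sq_nonneg x) (l := η / 2) (by positivity)
    (integral_exp_neg_mul_sq_gaussianReal_le (by positivity)) m _).trans ?_
  gcongr
  nlinarith [mul_le_mul_of_nonneg_right hm (sq_nonneg η)]

lemma gaussianMatrix_sum_sq_le {m M : ℕ} {n η : ℝ} (hη : 0 ≤ η) (hm : m ≤ n)
    {w : Fin M → ℝ} (hw : ∑ j, w j ^ 2 = 1) :
    gaussianMatrixMeasure m M {B | normSqMulVec B w ≤ m - n * η} ≤
      ENNReal.ofReal (Real.exp (-(n * η ^ 2 / 4))) := by
  have hmp : MeasurePreserving (fun (B : Fin m → Fin M → ℝ) i => ∑ j, B i j * w j)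
      (gaussianMatrixMeasure m M) (Measure.pi fun _ => gaussianReal 0 1) :=
    measurePreserving_pi _ _ fun _ => ⟨by fun_prop, map_sum_mul_pi_gaussianReal w hw⟩
  refine le_trans (le_of_eq ?_) (gaussian_pi_sum_sq_le hη hm)
  rw [← hmp.measure_preimage (measurableSet_le (by fun_prop) (by fun_prop)).nullMeasurableSet]
  rfl

lemma prod_measure_le_add {α β : Type*} [MeasurableSpace α] [MeasurableSpace β]
    (μ : Measure α) (ν : Measure β) [IsProbabilityMeasure μ] [IsProbabilityMeasure ν]
    {S : Set (α × β)} (hS : MeasurableSet S) {A : Set α} (hA : MeasurableSet A) {p : ENNReal}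
    (h : ∀ a, a ∉ A → ν {b | (a, b) ∈ S} ≤ p) : (μ.prod ν) S ≤ μ A + p := by
  rw [Measure.prod_apply hS]
  calc ∫⁻ a, ν (Prod.mk a ⁻¹' S) ∂μ ≤ ∫⁻ a, (A.indicator 1 a + p) ∂μ := by
        refine lintegral_mono fun a => ?_
        by_cases ha : a ∈ A
        · simpa [ha] using prob_le_one.trans le_self_add
        · rw [Set.indicator_of_notMem ha, zero_add]
          exact h a ha
    _ = μ A + p := by
        rw [lintegral_add_right _ measurable_const, lintegral_indicator_one hA]
        simp

lemma gaussianReal_Ioi_sqrt_add_le {t x : ℝ} (ht : 0 ≤ t) (hx : 0 ≤ x) :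
    gaussianReal 0 1 (Set.Ioi √(t + x)) ≤
      ENNReal.ofReal (Real.exp (-(x / 2))) * gaussianReal 0 1 (Set.Ioi √t) := by
  have hpos : ∀ z ∈ Set.Ioi √t, 0 < z := fun z hz => (Real.sqrt_nonneg t).trans_lt hz
  have himg : Set.Ioi √(t + x) ⊆ (fun z => √(z ^ 2 + x)) '' Set.Ioi √t := by
    intro y hy
    have hy0 : 0 < y := (Real.sqrt_nonneg _).trans_lt hy
    have hy2 : t + x < y ^ 2 := (Real.sqrt_lt' hy0).1 hy
    refine ⟨√(y ^ 2 - x), Real.sqrt_lt_sqrt ht (by linarith), ?_⟩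
    simp only
    rw [Real.sq_sqrt (by linarith), sub_add_cancel, Real.sqrt_sq hy0.le]
  have hderiv : ∀ z ∈ Set.Ioi √t, HasDerivWithinAt (fun z => √(z ^ 2 + x))
      (2 * z / (2 * √(z ^ 2 + x))) (Set.Ioi √t) z := by
    intro z hz
    have h1 : HasDerivAt (fun z : ℝ => z ^ 2 + x) (2 * z) z := by
      simpa using (hasDerivAt_pow 2 z).add_const x
    exact (h1.sqrt (by have := hpos z hz; positivity)).hasDerivWithinAt
  have hinj : Set.InjOn (fun z => √(z ^ 2 + x)) (Set.Ioi √t) := by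
    intro y hy z hz h
    simp only at h
    rw [Real.sqrt_inj (by positivity) (by positivity), add_left_inj] at h
    exact (pow_left_inj₀ (hpos y hy).le (hpos z hz).le two_ne_zero).1 h
  rw [gaussianReal_apply _ one_ne_zero, gaussianReal_apply _ one_ne_zero]
  refine (lintegral_mono_set himg).trans ?_
  rw [lintegral_image_eq_lintegral_abs_deriv_mul measurableSet_Ioi hderiv hinj,
    ← lintegral_const_mul _ (measurable_gaussianPDF 0 1)]
  refine setLIntegral_mono' measurableSet_Ioi fun z hz => ?_
  have hz0 := hpos z hz
  simp only [gaussianPDF]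
  rw [← ENNReal.ofReal_mul (abs_nonneg _), ← ENNReal.ofReal_mul (Real.exp_pos _).le]
  refine ENNReal.ofReal_le_ofReal ?_
  have habs : |2 * z / (2 * √(z ^ 2 + x))| ≤ 1 := by
    rw [abs_of_nonneg (by positivity), div_le_one (by positivity)]
    have : z ≤ √(z ^ 2 + x) := Real.le_sqrt_of_sq_le (by linarith)
    linarith
  have hpdf : gaussianPDFReal 0 1 √(z ^ 2 + x) =
      Real.exp (-(x / 2)) * gaussianPDFReal 0 1 z := by
    simp only [gaussianPDFReal, sub_zero, NNReal.coe_one, mul_one]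
    rw [Real.sq_sqrt (by positivity), mul_left_comm, ← Real.exp_add]
    ring_nf
  rw [hpdf]
  exact mul_le_of_le_one_left
    (mul_nonneg (Real.exp_pos _).le (gaussianPDFReal_nonneg _ _ _)) habs

lemma chiSq1_Ioi (t : ℝ) : chiSq1 (Set.Ioi t) = gaussianReal 0 1 {z | t < z ^ 2} :=
  Measure.map_apply (by fun_prop) measurableSet_Ioi

lemma chiSq1_Ioi_eq_two_mul {t : ℝ} (ht : 0 ≤ t) :
    chiSq1 (Set.Ioi t) = 2 * gaussianReal 0 1 (Set.Ioi √t) := by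
  have hneg : gaussianReal 0 1 (Set.Iio (-√t)) = gaussianReal 0 1 (Set.Ioi √t) := by
    have h : (gaussianReal 0 1).map (fun y => -y) = gaussianReal 0 1 := by
      simp [gaussianReal_map_neg]
    conv_rhs => rw [← h]
    rw [Measure.map_apply measurable_neg measurableSet_Ioi]
    congr 1
    ext z
    simp [lt_neg]
  have hset : {z : ℝ | t < z ^ 2} = Set.Ioi √t ∪ Set.Iio (-√t) := by
    ext z
    simp only [Set.mem_ofPred_eq, Set.mem_union, Set.mem_Ioi, Set.mem_Iio]
    rw [← Real.sqrt_lt_sqrt_iff ht, Real.sqrt_sq_eq_abs, lt_abs, lt_neg (a := √t)]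
  have hdisj : Disjoint (Set.Ioi √t) (Set.Iio (-√t)) := by
    rw [Set.disjoint_left]
    intro z hz hz'
    simp only [Set.mem_Ioi, Set.mem_Iio] at hz hz'
    linarith [Real.sqrt_nonneg t]
  rw [chiSq1_Ioi, hset, measure_union hdisj measurableSet_Iio, hneg, two_mul]

lemma chiSq1_Ioi_add_le {t x : ℝ} (ht : 0 ≤ t) (hx : 0 ≤ x) :
    chiSq1 (Set.Ioi (t + x)) ≤ ENNReal.ofReal (Real.exp (-(x / 2))) * chiSq1 (Set.Ioi t) := by
  rw [chiSq1_Ioi_eq_two_mul ht, chiSq1_Ioi_eq_two_mul (add_nonneg ht hx), mul_left_comm]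
  gcongr
  exact gaussianReal_Ioi_sqrt_add_le ht hx

instance : IsProbabilityMeasure chiSq1 :=
  Measure.isProbabilityMeasure_map (by fun_prop)

lemma chiSq1_Ioi_pos (t : ℝ) : 0 < chiSq1 (Set.Ioi t) := by
  rw [chiSq1_Ioi, pos_iff_ne_zero]
  refine fun h => (IsOpen.measure_pos volume (isOpen_lt continuous_const (by fun_prop)) ?_).ne'
    (gaussianReal_absolutelyContinuous' 0 one_ne_zero h)
  exact ⟨|t| + 1, by simp only [Set.mem_ofPred_eq]; nlinarith [abs_nonneg t, le_abs_self t]⟩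

lemma one_fifth_lt_chiSq1_Ioi_one : ENNReal.ofReal (1 / 5) < chiSq1 (Set.Ioi 1) := by
  have hset : {z : ℝ | 1 < z ^ 2} = (Set.Icc (-1) 1)ᶜ := by
    ext z
    simp only [Set.mem_ofPred_eq, Set.mem_compl_iff, Set.mem_Icc]
    rw [← abs_le, not_le, one_lt_sq_iff_one_lt_abs]
  have hpi : √(2 * Real.pi) > 2.505 := by
    refine Real.lt_sqrt_of_sq_lt ?_
    have := Real.pi_gt_d4
    norm_num at this ⊢
    linarith
  have hle : gaussianReal 0 1 (Set.Icc (-1) 1) ≤ ENNReal.ofReal (2 / 2.505) := by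
    rw [gaussianReal_apply _ one_ne_zero]
    calc _ ≤ ∫⁻ _ in Set.Icc (-1 : ℝ) 1, ENNReal.ofReal (1 / 2.505) := by
          refine lintegral_mono fun z => ENNReal.ofReal_le_ofReal ?_
          simp only [gaussianPDFReal, NNReal.coe_one, mul_one, one_div]
          calc _ ≤ (√(2 * Real.pi))⁻¹ * 1 := by
                gcongr
                rw [Real.exp_le_one_iff]
                have := sq_nonneg (z - 0)
                linarith
            _ ≤ _ := by rw [mul_one]; gcongr
      _ = _ := by
          rw [setLIntegral_const, Real.volume_Icc, ← ENNReal.ofReal_mul (by norm_num)]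
          norm_num
  rw [chiSq1_Ioi, hset, prob_compl_eq_one_sub measurableSet_Icc]
  calc ENNReal.ofReal (1 / 5) < ENNReal.ofReal (1 - 2 / 2.505) :=
        (ENNReal.ofReal_lt_ofReal_iff (by norm_num)).2 (by norm_num)
    _ = 1 - ENNReal.ofReal (2 / 2.505) := by
        rw [ENNReal.ofReal_sub _ (by norm_num), ENNReal.ofReal_one]
    _ ≤ _ := tsub_le_tsub_left hle 1

lemma lintegral_chiSq1_Ioi_sub_le {t : ℝ} (ht : 0 ≤ t) :
    ∫⁻ y in Set.Ioi t, ENNReal.ofReal (y - t) ∂chiSq1 ≤ 2 * chiSq1 (Set.Ioi t) := by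
  rw [lintegral_eq_lintegral_meas_lt _ _ (by fun_prop)]
  · have hexp : ∫⁻ x in Set.Ioi (0 : ℝ), ENNReal.ofReal (Real.exp (-(x / 2))) = 2 := by
      have h := integrableOn_exp_mul_Ioi (a := -(1 / 2)) (by norm_num) 0
      have h2 := integral_exp_mul_Ioi (a := -(1 / 2)) (by norm_num) 0
      rw [← ofReal_integral_eq_lintegral_ofReal]
      · have : (fun x : ℝ => Real.exp (-(x / 2))) = fun x => Real.exp (-(1 / 2) * x) := by
          ext x
          ring_nf
        rw [this, h2]
        norm_num
      · exact h.congr_fun (fun x _ => by ring_nf) measurableSet_Ioi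
      · exact ae_of_all _ fun x => (Real.exp_pos _).le
    calc _ ≤ ∫⁻ x in Set.Ioi (0 : ℝ), ENNReal.ofReal (Real.exp (-(x / 2))) *
            chiSq1 (Set.Ioi t) := by
          refine setLIntegral_mono' measurableSet_Ioi fun x hx => ?_
          refine le_trans ?_ (chiSq1_Ioi_add_le ht (le_of_lt hx))
          refine (Measure.restrict_apply_le _ _).trans (measure_mono fun y hy => ?_)
          simp only [Set.mem_ofPred_eq, Set.mem_Ioi] at hy ⊢
          linarith
      _ = _ := by rw [lintegral_mul_const _ (by fun_prop), hexp]
  · filter_upwards [ae_restrict_mem measurableSet_Ioi] with y hy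
    simpa using le_of_lt hy

lemma condExpGt_le {t : ℝ} (ht : 0 ≤ t) : condExpGt t ≤ t + 2 := by
  have hne : chiSq1 (Set.Ioi t) ≠ ⊤ := measure_ne_top _ _
  have hpos : 0 < (chiSq1 (Set.Ioi t)).toReal := ENNReal.toReal_pos (chiSq1_Ioi_pos t).ne' hne
  rw [condExpGt, div_le_iff₀ hpos, integral_eq_lintegral_of_nonneg_ae _ (by fun_prop)]
  · have hle : ∫⁻ y in Set.Ioi t, ENNReal.ofReal y ∂chiSq1 ≤
        ENNReal.ofReal (t + 2) * chiSq1 (Set.Ioi t) := by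
      calc _ ≤ ∫⁻ y in Set.Ioi t, (ENNReal.ofReal (y - t) + ENNReal.ofReal t) ∂chiSq1 := by
            refine lintegral_mono fun y => ?_
            calc _ = ENNReal.ofReal ((y - t) + t) := by rw [sub_add_cancel]
              _ ≤ _ := ENNReal.ofReal_add_le
        _ ≤ 2 * chiSq1 (Set.Ioi t) + ENNReal.ofReal t * chiSq1 (Set.Ioi t) := by
            rw [lintegral_add_right _ measurable_const, setLIntegral_const]
            gcongr
            exact lintegral_chiSq1_Ioi_sub_le ht
        _ = _ := by
            rw [ENNReal.ofReal_add ht (by norm_num), ENNReal.ofReal_ofNat]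
            ring
    refine (ENNReal.toReal_mono (ENNReal.mul_ne_top ENNReal.ofReal_ne_top hne) hle).trans ?_
    rw [ENNReal.toReal_mul, ENNReal.toReal_ofReal (by linarith)]
  · filter_upwards [ae_restrict_mem measurableSet_Ioi] with y hy
    exact ht.trans (le_of_lt hy)

lemma gaussian_pi_card_le {M k : ℕ} {θ x : ℝ} (hx : 0 ≤ x)
    (h : k * Real.exp x ≤ M * (chiSq1 (Set.Ioi θ)).toReal) :
    (Measure.pi fun _ : Fin M => gaussianReal 0 1)
        {b | (Finset.univ.filter fun j => θ < b j ^ 2).card ≤ k} ≤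
      ENNReal.ofReal (Real.exp (-(k * (x ^ 2 / 2)))) := by
  classical
  set S : Set ℝ := {z | θ < z ^ 2}
  have hS : MeasurableSet S := measurableSet_lt measurable_const (by fun_prop)
  set r := (gaussianReal 0 1).real S
  have hr : (chiSq1 (Set.Ioi θ)).toReal = r := by rw [chiSq1_Ioi]; rfl
  have hint : ∫ z, Real.exp (-x * S.indicator 1 z) ∂(gaussianReal 0 1) ≤
      Real.exp (-(r * (1 - Real.exp (-x)))) := by
    have h1 : ∀ z, Real.exp (-x * S.indicator 1 z) =
        1 + S.indicator (fun _ => Real.exp (-x) - 1) z := by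
      intro z
      by_cases hz : z ∈ S <;> simp [hz]
    simp only [h1]
    rw [integral_add (by fun_prop) ((integrable_const _).indicator hS),
      integral_indicator_const _ hS]
    simp only [integral_const, probReal_univ, smul_eq_mul, mul_one]
    have := Real.add_one_le_exp (-(r * (1 - Real.exp (-x))))
    linarith
  have hcard : ∀ b : Fin M → ℝ, ((Finset.univ.filter fun j => θ < b j ^ 2).card : ℝ) =
      ∑ j, S.indicator 1 (b j) := by
    intro b
    rw [Finset.card_filter]
    push_cast
    rfl
  have hmain := measure_pi_sum_le (gaussianReal 0 1) (f := S.indicator 1)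
    (measurable_one.indicator hS) (fun z => Set.indicator_nonneg (by simp) z) hx hint M k
  refine le_trans (measure_mono fun b hb => ?_) (hmain.trans ?_)
  · simp only [Set.mem_ofPred_eq] at hb ⊢
    rw [← hcard]
    exact_mod_cast hb
  · gcongr
    rw [hr] at h
    have h2 := Real.quadratic_le_exp_of_nonneg hx
    have h3 : Real.exp x * Real.exp (-x) = 1 := by rw [← Real.exp_add]; simp
    have h4 : 0 ≤ 1 - Real.exp (-x) := by
      rw [sub_nonneg, Real.exp_le_one_iff]
      linarith
    have h5 := mul_le_mul_of_nonneg_right h h4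
    have h6 : (k : ℝ) * Real.exp x * (1 - Real.exp (-x)) = k * (Real.exp x - 1) := by
      linear_combination -(k : ℝ) * h3
    have h7 := mul_le_mul_of_nonneg_left h2 (Nat.cast_nonneg (α := ℝ) k)
    nlinarith

lemma exists_threshold {M k : ℕ} {t : ℝ} (hk : 0 < k) (hM : 5 * k < M)
    (ht : chiSq1 (Set.Ioi t) = ENNReal.ofReal (k / M)) :
    1 < t ∧ ∃ θ : ℝ, 0 ≤ θ ∧ 0.27 * ((k + 1) * (t + 2)) ≤ k * θ ∧
      (Measure.pi fun _ : Fin M => gaussianReal 0 1)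
        {b | (Finset.univ.filter fun j => θ < b j ^ 2).card ≤ k} ≤
      ENNReal.ofReal (3 * Real.exp (-((k + 1) * (t + 2) / 9600))) := by
  have hk1 : (1 : ℝ) ≤ k := by exact_mod_cast hk
  have hM' : 5 * (k : ℝ) < M := by exact_mod_cast hM
  have hM0 : (0 : ℝ) < M := by linarith
  have ht1 : 1 < t := by
    by_contra! h
    have h1 := one_fifth_lt_chiSq1_Ioi_one.trans_le
      (measure_mono (μ := chiSq1) (Set.Ioi_subset_Ioi h))
    rw [ht, ENNReal.ofReal_lt_ofReal_iff (by positivity), div_lt_div_iff₀ (by norm_num) hM0] at h1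
    linarith
  have hq : (chiSq1 (Set.Ioi t)).toReal = k / M := by
    rw [ht, ENNReal.toReal_ofReal (by positivity)]
  have key : ∀ θ x : ℝ, 0 ≤ θ → 0 ≤ x → t = θ + 2 * x →
      (t + 2) / 4800 ≤ x ^ 2 / 2 →
      (Measure.pi fun _ : Fin M => gaussianReal 0 1)
        {b | (Finset.univ.filter fun j => θ < b j ^ 2).card ≤ k} ≤
      ENNReal.ofReal (3 * Real.exp (-((k + 1) * (t + 2) / 9600))) := by
    intro θ x hθ hx htx hxx
    refine (gaussian_pi_card_le hx ?_).trans (ENNReal.ofReal_le_ofReal ?_)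
    · have h1 := chiSq1_Ioi_add_le hθ (x := 2 * x) (by positivity)
      have h2 := ENNReal.toReal_mono (ENNReal.mul_ne_top ENNReal.ofReal_ne_top
        (measure_ne_top _ _)) h1
      rw [← htx, hq, ENNReal.toReal_mul, ENNReal.toReal_ofReal (Real.exp_pos _).le,
        show 2 * x / 2 = x by ring, div_le_iff₀ hM0] at h2
      have h3 : Real.exp x * Real.exp (-x) = 1 := by rw [← Real.exp_add]; simp
      calc _ ≤ Real.exp (-x) * (chiSq1 (Set.Ioi θ)).toReal * M * Real.exp x := by gcongr
        _ = _ := by linear_combination (M : ℝ) * (chiSq1 (Set.Ioi θ)).toReal * h3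
    · calc _ ≤ Real.exp (-((k + 1) * (t + 2) / 9600)) := by
            refine Real.exp_le_exp.2 (neg_le_neg ?_)
            nlinarith
        _ ≤ _ := by linarith [Real.exp_pos (-(((k : ℝ) + 1) * (t + 2) / 9600))]
  refine ⟨ht1, ?_⟩
  rcases le_or_gt 4 t with h4 | h4
  · exact ⟨0.6 * (t + 2), by positivity, by nlinarith,
      key _ (0.2 * t - 0.6) (by positivity) (by linarith) (by ring) (by nlinarith)⟩
  · rcases le_or_gt 9 k with h9 | h9
    · have h9' : (9 : ℝ) ≤ k := by exact_mod_cast h9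
      exact ⟨0.3 * (t + 2), by positivity, by nlinarith,
        key _ (0.35 * t - 0.3) (by positivity) (by linarith) (by ring) (by nlinarith)⟩
    · refine ⟨0.6 * (t + 2), by positivity, by nlinarith, prob_le_one.trans ?_⟩
      have h9' : (k : ℝ) ≤ 9 := by exact_mod_cast h9.le
      rw [ENNReal.one_le_ofReal]
      have h1 : -1 ≤ -(((k : ℝ) + 1) * (t + 2) / 9600) := by nlinarith
      have h2 := Real.exp_le_exp.2 h1
      have h3 := Real.exp_one_lt_d9
      have h4 : Real.exp 1 * Real.exp (-1) = 1 := by rw [← Real.exp_add]; simp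
      nlinarith [Real.exp_pos (-1)]

lemma exists_isometry_eq_norm_smul {m : ℕ} (a : EuclideanSpace ℝ (Fin (m + 1))) :
    ∃ U : EuclideanSpace ℝ (Fin (m + 1)) ≃ₗᵢ[ℝ] EuclideanSpace ℝ (Fin (m + 1)),
      U a = EuclideanSpace.single 0 ‖a‖ :=
  ⟨_, Submodule.reflection_sub (v := a) (w := EuclideanSpace.single 0 ‖a‖) (by simp)⟩

lemma exists_sparse_le_sum_mul {M k : ℕ} (hk : 0 < k) {θ : ℝ} (hθ : 0 ≤ θ) {b : Fin M → ℝ}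
    (hb : k ≤ (Finset.univ.filter fun j => θ < b j ^ 2).card) :
    ∃ w ∈ sparseUnitVecs M k, √(k * θ) ≤ ∑ j, b j * w j := by
  classical
  obtain ⟨J, hJ, hJk⟩ := Finset.exists_subset_card_eq hb
  have hk0 : (0 : ℝ) < k := by exact_mod_cast hk
  have hJb : ∀ j ∈ J, θ < b j ^ 2 := fun j hj => (Finset.mem_filter.1 (hJ hj)).2
  have hne : ∀ j ∈ J, b j ≠ 0 := by
    intro j hj h0
    have := hJb j hj
    rw [h0] at this
    norm_num at this
    linarith
  refine ⟨fun j => if j ∈ J then SignType.sign (b j) / √k else 0, ⟨?_, ?_⟩, ?_⟩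
  · have : ∀ j, (if j ∈ J then (SignType.sign (b j) : ℝ) / √k else 0) ^ 2 =
        if j ∈ J then 1 / (k : ℝ) else 0 := by
      intro j
      split_ifs with h
      · rw [div_pow, Real.sq_sqrt hk0.le]
        rcases (hne j h).lt_or_gt with h' | h' <;> simp [h']
      · simp
    simp only [this]
    rw [Finset.sum_ite_mem, Finset.univ_inter, Finset.sum_const, hJk, nsmul_eq_mul]
    field_simp
  · rw [← hJk]
    refine Finset.card_le_card fun j hj => ?_
    by_contra h
    simp [h] at hj
  · have h1 : ∀ j, b j * (if j ∈ J then (SignType.sign (b j) : ℝ) / √k else 0) =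
        if j ∈ J then |b j| / √k else 0 := by
      intro j
      split_ifs with h
      · rw [← mul_div_assoc, mul_comm, sign_mul_self]
      · simp
    simp only [h1]
    rw [Finset.sum_ite_mem, Finset.univ_inter, Real.sqrt_mul hk0.le]
    calc √k * √θ = ∑ j ∈ J, √θ / √k := by
          rw [Finset.sum_const, hJk, nsmul_eq_mul]
          have := Real.sqrt_pos.2 hk0
          field_simp
          rw [Real.sq_sqrt hk0.le, mul_comm]
      _ ≤ _ := by
          refine Finset.sum_le_sum fun j hj => ?_
          gcongr
          exact (Real.sqrt_lt_sqrt hθ (hJb j hj)).le.trans (Real.sqrt_sq_eq_abs _).le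

lemma isClosed_forall_sum_sq_le {ι κ X : Type*} [Fintype ι] [TopologicalSpace X] (W : Set κ)
    (f : κ → X → ι → ℝ) (hf : ∀ w i, Continuous fun x => f w x i) (c : ℝ) :
    IsClosed {x | ∀ w ∈ W, ∑ i, f w x i ^ 2 ≤ c} := by
  simp only [Set.ofPred_forall]
  refine isClosed_biInter fun w _ => isClosed_le ?_ continuous_const
  exact continuous_finsetSum _ fun i _ => (hf w i).pow 2

lemma sum_sq_add_mulVec_eq_isometry {n M : ℕ}
    (U : EuclideanSpace ℝ (Fin n) ≃ₗᵢ[ℝ] EuclideanSpace ℝ (Fin n)) (a : Fin n → ℝ)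
    (B : Fin n → Fin M → ℝ) (w : Fin M → ℝ) :
    ∑ i, (U (WithLp.toLp 2 a) i + ∑ j, U (WithLp.toLp 2 fun l => B l j) i * w j) ^ 2 =
      ∑ i, (a i + ∑ j, B i j * w j) ^ 2 := by
  set v : EuclideanSpace ℝ (Fin n) :=
    WithLp.toLp 2 a + ∑ j, w j • WithLp.toLp 2 fun l => B l j with hv
  have h1 : ‖U v‖ ^ 2 = ‖v‖ ^ 2 := by rw [U.norm_map]
  have h2 : ∀ i, U v i =
      U (WithLp.toLp 2 a) i + ∑ j, U (WithLp.toLp 2 fun l => B l j) i * w j := by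
    intro i
    simp [hv, mul_comm]
  have h3 : ∀ i, v i = a i + ∑ j, B i j * w j := by
    intro i
    simp [hv, mul_comm]
  simpa only [EuclideanSpace.real_norm_sq_eq, h2, h3] using h1

lemma gaussianMatrix_forall_sparse_single_le {m M k : ℕ} (hk : 0 < k) {θ n η c R : ℝ}
    (hθ : 0 ≤ θ) (hη : 0 ≤ η) (hm : m ≤ n) (hR : 0 ≤ R)
    (h : ∀ y, 0 ≤ y → m - n * η < y → c < (R + √(k * θ)) ^ 2 + y) :
    gaussianMatrixMeasure (m + 1) M
        {B | ∀ w ∈ sparseUnitVecs M k,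
          ∑ i, ((Pi.single 0 R : Fin (m + 1) → ℝ) i + ∑ j, B i j * w j) ^ 2 ≤ c} ≤
      (Measure.pi fun _ : Fin M => gaussianReal 0 1)
        {b | (Finset.univ.filter fun j => θ < b j ^ 2).card ≤ k} +
      ENNReal.ofReal (Real.exp (-(n * η ^ 2 / 4))) := by
  set S : Set ((Fin M → ℝ) × (Fin m → Fin M → ℝ)) :=
    {p | ∀ w ∈ sparseUnitVecs M k, (R + ∑ j, p.1 j * w j) ^ 2 + normSqMulVec p.2 w ≤ c}
  have hS : MeasurableSet S := by
    simp only [S, Set.ofPred_forall]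
    refine (isClosed_biInter fun w _ => isClosed_le ?_ continuous_const).measurableSet
    unfold normSqMulVec
    fun_prop
  have hsplit := measurePreserving_piFinSuccAbove
    (fun _ : Fin (m + 1) => Measure.pi fun _ : Fin M => gaussianReal 0 1) 0
  have hpre : {B | ∀ w ∈ sparseUnitVecs M k,
      ∑ i, ((Pi.single 0 R : Fin (m + 1) → ℝ) i + ∑ j, B i j * w j) ^ 2 ≤ c} =
      MeasurableEquiv.piFinSuccAbove (fun _ => Fin M → ℝ) 0 ⁻¹' S := by
    ext B
    simp only [Set.mem_ofPred_eq, Set.mem_preimage, S, Fin.sum_univ_succ]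
    simp [normSqMulVec, Fin.tail]
  have hcard : MeasurableSet {b : Fin M → ℝ |
      (Finset.univ.filter fun j => θ < b j ^ 2).card ≤ k} := by
    simp only [Finset.card_filter]
    refine measurableSet_le (Finset.measurable_sum _ fun j _ => ?_) measurable_const
    exact Measurable.ite (measurableSet_lt measurable_const (by fun_prop))
      measurable_const measurable_const
  rw [hpre, gaussianMatrixMeasure, hsplit.measure_preimage hS.nullMeasurableSet]
  refine prod_measure_le_add _ _ hS hcard fun b hb => ?_
  simp only [Set.mem_ofPred_eq, not_le] at hb
  obtain ⟨w, hw, hwb⟩ := exists_sparse_le_sum_mul hk hθ hb.le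
  refine le_trans (measure_mono fun B hB => ?_) (gaussianMatrix_sum_sq_le hη hm hw.1)
  have h1 : (R + ∑ j, b j * w j) ^ 2 + normSqMulVec B w ≤ c := hB w hw
  simp only [Set.mem_ofPred_eq]
  by_contra! h2
  have h3 := h _ (Finset.sum_nonneg fun i _ => sq_nonneg _) h2
  have h4 : (R + √(k * θ)) ^ 2 ≤ (R + ∑ j, b j * w j) ^ 2 := by gcongr
  simp only [normSqMulVec] at h1 h3
  linarith

lemma gaussianMatrix_forall_sparse_le {m M k : ℕ} (hk : 0 < k) {θ n η c : ℝ} (hθ : 0 ≤ θ)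
    (hη : 0 ≤ η) (hm : m ≤ n) (a : Fin (m + 1) → ℝ)
    (h : ∀ y, 0 ≤ y → m - n * η < y → c < (√(∑ i, a i ^ 2) + √(k * θ)) ^ 2 + y) :
    gaussianMatrixMeasure (m + 1) M
        {B | ∀ w ∈ sparseUnitVecs M k, ∑ i, (a i + ∑ j, B i j * w j) ^ 2 ≤ c} ≤
      (Measure.pi fun _ : Fin M => gaussianReal 0 1)
        {b | (Finset.univ.filter fun j => θ < b j ^ 2).card ≤ k} +
      ENNReal.ofReal (Real.exp (-(n * η ^ 2 / 4))) := by
  refine le_trans (le_of_eq ?_)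
    (gaussianMatrix_forall_sparse_single_le hk hθ hη hm (Real.sqrt_nonneg _) h)
  obtain ⟨U, hU⟩ := exists_isometry_eq_norm_smul (WithLp.toLp 2 a)
  have hR : ‖(WithLp.toLp 2 a : EuclideanSpace ℝ (Fin (m + 1)))‖ = √(∑ i, a i ^ 2) := by
    simp [EuclideanSpace.norm_eq]
  rw [hR] at hU
  rw [← (measurePreserving_isometry_matrix M U).measure_preimage
    (isClosed_forall_sum_sq_le (sparseUnitVecs M k)
      (fun w (B : Fin (m + 1) → Fin M → ℝ) i =>
        (Pi.single 0 √(∑ i, a i ^ 2) : Fin (m + 1) → ℝ) i + ∑ j, B i j * w j)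
      (fun w i => by fun_prop) c).measurableSet.nullMeasurableSet]
  congr 1
  ext B
  have hrot := sum_sq_add_mulVec_eq_isometry U a B
  simp only [hU, PiLp.single_apply] at hrot
  simp only [Set.mem_ofPred_eq, Set.mem_preimage, Pi.single_apply, hrot]

instance (n N : ℕ) : IsProbabilityMeasure (gaussianMatrixMeasure n N) := by
  unfold gaussianMatrixMeasure
  infer_instance

lemma measurePreserving_gaussianMatrix_split (n M : ℕ) :
    MeasurePreserving
      (fun A : Fin n → Fin (M + 1) → ℝ => (fun i => A i 0, fun i j => A i (Fin.succ j)))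
      (gaussianMatrixMeasure n (M + 1))
      ((Measure.pi fun _ : Fin n => gaussianReal 0 1).prod (gaussianMatrixMeasure n M)) := by
  have h1 := measurePreserving_pi
    (fun _ : Fin n => Measure.pi fun _ : Fin (M + 1) => gaussianReal 0 1)
    (fun _ : Fin n => (gaussianReal 0 1).prod (Measure.pi fun _ : Fin M => gaussianReal 0 1))
    fun _ => measurePreserving_piFinSuccAbove (fun _ : Fin (M + 1) => gaussianReal 0 1) 0
  exact (measurePreserving_arrowProdEquivProdArrow ℝ (Fin M → ℝ) (Fin n)
    (fun _ => gaussianReal 0 1) (fun _ => Measure.pi fun _ => gaussianReal 0 1)).comp h1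

lemma gaussianMatrix_forall_sparse_cons_le {m M k : ℕ} (hk : 0 < k) {θ n η c : ℝ}
    (hθ : 0 ≤ θ) (hη : 0 ≤ η) (hm : (m + 1 : ℕ) ≤ n)
    (h : ∀ r y, 0 ≤ r → (m + 1 : ℕ) - n * η < r → 0 ≤ y → m - n * η < y →
      c < (√r + √(k * θ)) ^ 2 + y) :
    gaussianMatrixMeasure (m + 1) (M + 1)
        {A | ∀ w ∈ sparseUnitVecs M k, ∑ i, (A i 0 + ∑ j, A i (Fin.succ j) * w j) ^ 2 ≤ c} ≤
      ENNReal.ofReal (Real.exp (-(n * η ^ 2 / 4))) +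
      ((Measure.pi fun _ : Fin M => gaussianReal 0 1)
        {b | (Finset.univ.filter fun j => θ < b j ^ 2).card ≤ k} +
      ENNReal.ofReal (Real.exp (-(n * η ^ 2 / 4)))) := by
  set S : Set ((Fin (m + 1) → ℝ) × (Fin (m + 1) → Fin M → ℝ)) :=
    {p | ∀ w ∈ sparseUnitVecs M k, ∑ i, (p.1 i + ∑ j, p.2 i j * w j) ^ 2 ≤ c}
  have hS : MeasurableSet S :=
    (isClosed_forall_sum_sq_le (sparseUnitVecs M k)
      (fun w (p : (Fin (m + 1) → ℝ) × (Fin (m + 1) → Fin M → ℝ)) i =>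
        p.1 i + ∑ j, p.2 i j * w j) (fun w i => by fun_prop) c).measurableSet
  have hpre := (measurePreserving_gaussianMatrix_split (m + 1) M).measure_preimage
    hS.nullMeasurableSet
  refine (hpre.trans_le (prod_measure_le_add _ _ hS
    (A := {a | ∑ i, a i ^ 2 ≤ (m + 1 : ℕ) - n * η}) ?_ fun a ha => ?_)).trans
    (add_le_add_left (gaussian_pi_sum_sq_le hη hm) _)
  · exact measurableSet_le (by fun_prop) measurable_const
  · simp only [Set.mem_ofPred_eq, not_le] at ha
    refine gaussianMatrix_forall_sparse_le hk hθ hη ?_ a fun y hy hy' =>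
      h _ y (Finset.sum_nonneg fun i _ => sq_nonneg _) ha hy hy'
    exact le_trans (by simp) hm

lemma neg_one_le_ripPlus {n N s : ℕ} (A : Fin n → Fin N → ℝ) : -1 ≤ ripPlus n N s A := by
  have : 0 ≤ sSup (normSqMulVec A '' sparseUnitVecs N s) := by
    refine Real.sSup_nonneg ?_
    rintro _ ⟨x, -, rfl⟩
    exact Finset.sum_nonneg fun i _ => sq_nonneg _
  unfold ripPlus
  linarith

lemma normSqMulVec_sub_one_le_ripPlus {n N s : ℕ} (A : Fin n → Fin N → ℝ) {x : Fin N → ℝ}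
    (hx : x ∈ sparseUnitVecs N s) : normSqMulVec A x - 1 ≤ ripPlus n N s A := by
  refine sub_le_sub_right (le_csSup ⟨∑ i, ∑ j, A i j ^ 2, ?_⟩ (Set.mem_image_of_mem _ hx)) 1
  rintro _ ⟨y, hy, rfl⟩
  refine Finset.sum_le_sum fun i _ => ?_
  have h := Finset.sum_mul_sq_le_sq_mul_sq Finset.univ (A i) y
  rwa [hy.1, mul_one] at h

lemma cons_mem_sparseUnitVecs {M k : ℕ} {w : Fin M → ℝ} (hw : w ∈ sparseUnitVecs M k) :
    (Fin.cons (1 / √2) fun j => w j / √2 : Fin (M + 1) → ℝ) ∈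
      sparseUnitVecs (M + 1) (k + 1) := by
  refine ⟨?_, ?_⟩
  · rw [Fin.sum_univ_succ]
    simp only [Fin.cons_zero, Fin.cons_succ, div_pow, ← Finset.sum_div, hw.1]
    norm_num
  · rw [Fin.univ_succ, Finset.filter_cons]
    have h := hw.2
    simp only [Finset.filter_map, Function.comp_def, Function.Embedding.coeFn_mk, Fin.cons_zero,
      Fin.cons_succ]
    split_ifs
    · rw [Finset.card_cons, Finset.card_map]
      simpa using h
    · rw [Finset.card_map]
      simpa using h.trans (Nat.le_succ k)

lemma single_mem_sparseUnitVecs {M s : ℕ} (hs : 1 ≤ s) :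
    (Pi.single 0 1 : Fin (M + 1) → ℝ) ∈ sparseUnitVecs (M + 1) s := by
  refine ⟨by simp [Pi.single_apply], ?_⟩
  simpa [Pi.single_apply, Finset.filter_eq'] using hs

lemma normSqMulVec_div {n N : ℕ} (A : Fin n → Fin N → ℝ) (x : Fin N → ℝ) :
    normSqMulVec (fun i j => A i j / √n) x = normSqMulVec A x / n := by
  unfold normSqMulVec
  rw [Finset.sum_div]
  refine Finset.sum_congr rfl fun i _ => ?_
  simp only [div_mul_eq_mul_div, ← Finset.sum_div, div_pow]
  rw [Real.sq_sqrt (by positivity)]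

lemma normSqMulVec_div_cons {n M : ℕ} (A : Fin n → Fin (M + 1) → ℝ) (w : Fin M → ℝ) :
    normSqMulVec (fun i j => A i j / √n) (Fin.cons (1 / √2) fun j => w j / √2) =
      (∑ i, (A i 0 + ∑ j, A i (Fin.succ j) * w j) ^ 2) / (2 * n) := by
  rw [normSqMulVec_div, ← div_div]
  congr 1
  rw [normSqMulVec, Finset.sum_div]
  refine Finset.sum_congr rfl fun i _ => ?_
  rw [Fin.sum_univ_succ]
  simp only [Fin.cons_zero, Fin.cons_succ, ← mul_div_assoc, ← Finset.sum_div, mul_one]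
  rw [← add_div, div_pow, Real.sq_sqrt (by positivity)]

lemma ofReal_one_sub_le_gaussianMatrixMeasure {n N : ℕ} {S F : Set (Fin n → Fin N → ℝ)} {p : ℝ}
    (hp : 0 ≤ p) (hF : gaussianMatrixMeasure n N F ≤ ENNReal.ofReal p)
    (hSF : ∀ A, A ∉ F → A ∈ S) :
    ENNReal.ofReal (1 - p) ≤ gaussianMatrixMeasure n N S := by
  rw [ENNReal.ofReal_sub _ hp, ENNReal.ofReal_one, tsub_le_iff_right,
    ← measure_univ (μ := gaussianMatrixMeasure n N)]
  refine (measure_mono fun A _ => ?_).trans ((measure_union_le S F).trans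
    (add_le_add_right hF _))
  by_cases h : A ∈ F
  exacts [Or.inr h, Or.inl (hSF A h)]

lemma exp_tail_ge_one {x : ℝ} (hx : x < 6000) : 1 ≤ 4000000 * Real.exp (-x / 4000000) := by
  have := Real.add_one_le_exp (-x / 4000000)
  linarith

lemma quadratic_lt_sq_of_six_le {u v a y ε : ℝ} (hε : 6 ≤ ε) (hu : 0 ≤ u) (hv : 0 ≤ v)
    (huv : 0.27 * u ^ 2 ≤ v ^ 2) (ha : 0 ≤ a) (hy : 0 ≤ y) :
    4 * ((1 + u) * (1 - ε) + u ^ 2 / 2) < ((a + v) ^ 2 + y) ^ 2 := by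
  have hD : 0.27 * u ^ 2 ≤ (a + v) ^ 2 + y := by nlinarith [mul_nonneg ha hv, sq_nonneg a]
  have hQ : 4 * ((1 + u) * (1 - ε) + u ^ 2 / 2) ≤ 2 * u ^ 2 - 20 * (1 + u) := by nlinarith
  have hD2 : (0.27 * u ^ 2) ^ 2 ≤ ((a + v) ^ 2 + y) ^ 2 := by gcongr
  rcases le_total u 10 with h | h <;> nlinarith [sq_nonneg u, sq_nonneg ((a + v) ^ 2 + y)]

lemma quadratic_lt_sq_of_lt_six {u v a y ε : ℝ} (hε : 0 < ε) (hε6 : ε < 6) (hu : 0 ≤ u)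
    (hv : 0 ≤ v) (huv : 0.27 * u ^ 2 ≤ v ^ 2) (ha : 0 ≤ a) (ha2 : 1 - ε / 1000 ≤ a ^ 2)
    (hy : 1 - 2 * (ε / 1000) ≤ y) :
    4 * ((1 + u) * (1 - ε) + u ^ 2 / 2) < ((a + v) ^ 2 + y) ^ 2 := by
  have hv' : 0.51 * u ≤ v := by
    refine abs_le_of_sq_le_sq' ?_ hv |>.2
    nlinarith [sq_nonneg u]
  have ha' : 1 - ε / 1000 ≤ a := by
    refine abs_le_of_sq_le_sq' ?_ ha |>.2
    nlinarith
  have hD : (1 - 1.5 * (ε / 1000)) * (2 + 2 * v + v ^ 2) ≤ (a + v) ^ 2 + y := by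
    nlinarith [mul_nonneg hε.le hv, mul_le_mul_of_nonneg_right ha' hv,
      mul_nonneg hε.le (sq_nonneg v)]
  have hη : 0 ≤ 1 - 1.5 * (ε / 1000) := by linarith
  have hD2 : ((1 - 1.5 * (ε / 1000)) * (2 + 2 * v + v ^ 2)) ^ 2 ≤ ((a + v) ^ 2 + y) ^ 2 := by
    gcongr
  have hg : 4 * (1 + 1.02 * u + 0.54 * u ^ 2) ≤ (2 + 2 * v + v ^ 2) ^ 2 := by
    nlinarith [pow_nonneg hv 3, pow_nonneg hv 4]
  have hη2 : 1 - 3 * (ε / 1000) ≤ (1 - 1.5 * (ε / 1000)) ^ 2 := by nlinarith [sq_nonneg ε]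
  have hη3 : 0 ≤ 1 - 3 * (ε / 1000) := by linarith
  have hmul : (1 - 3 * (ε / 1000)) * (4 * (1 + 1.02 * u + 0.54 * u ^ 2)) ≤
      ((1 - 1.5 * (ε / 1000)) * (2 + 2 * v + v ^ 2)) ^ 2 := by
    rw [mul_pow]
    gcongr
  have h1 : ε * u ^ 2 ≤ 6 * u ^ 2 := by gcongr
  nlinarith [mul_nonneg hε.le hu, sq_nonneg u]

lemma quadratic_le_of_lt_div_ten {u ε : ℝ} (hε : 0 < ε) (hu : 0 ≤ u) (h : u < ε / 10) :
    (1 + u) * (1 - ε) + u ^ 2 / 2 ≤ 0 ∨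
      0 ≤ 1 - ε / 1000 ∧ (1 + u) * (1 - ε) + u ^ 2 / 2 ≤ (1 - ε / 1000) ^ 2 := by
  rcases le_or_gt 6 ε with h6 | h6
  · exact Or.inl (by nlinarith)
  · exact Or.inr ⟨by linarith, by nlinarith [mul_nonneg hε.le hu]⟩

lemma two_mul_sqrt_lt_of_sq_lt {n Q r y κ : ℝ} (hn : 0 < n) (hr : 0 ≤ r) (hκ : 0 < κ)
    (hy : 0 ≤ y) (h : 4 * Q < ((√(r / n) + √(κ / n)) ^ 2 + y / n) ^ 2) :
    2 * n * √Q < (√r + √κ) ^ 2 + y := by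
  have hsn := Real.sqrt_pos.2 hn
  have heq : (√(r / n) + √(κ / n)) ^ 2 + y / n = ((√r + √κ) ^ 2 + y) / n := by
    rw [Real.sqrt_div hr, Real.sqrt_div hκ.le, ← add_div, div_pow, Real.sq_sqrt hn.le, add_div]
  rw [heq] at h
  have hκ' := Real.sqrt_pos.2 hκ
  have hlt : √Q < ((√r + √κ) ^ 2 + y) / n / 2 := by
    rw [Real.sqrt_lt' (by positivity)]
    linarith
  rw [div_div, lt_div_iff₀ (by positivity)] at hlt
  linarith

lemma two_mul_sqrt_quadratic_lt {n ε u κ r y : ℝ} (hn : 0 < n) (hε : 0 < ε)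
    (hnε : 6000 ≤ n * ε ^ 2) (hu : 0 < u) (hκ : 0.27 * (n * u ^ 2) ≤ κ) (hr : 0 ≤ r)
    (hr' : n - n * (ε / 1000) < r) (hy : 0 ≤ y) (hy' : n - 1 - n * (ε / 1000) < y) :
    2 * n * √((1 + u) * (1 - ε) + u ^ 2 / 2) < (√r + √κ) ^ 2 + y := by
  have hκ0 : 0 < κ := lt_of_lt_of_le (by positivity) hκ
  refine two_mul_sqrt_lt_of_sq_lt hn hr hκ0 hy ?_
  have huv : 0.27 * u ^ 2 ≤ √(κ / n) ^ 2 := by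
    rw [Real.sq_sqrt (by positivity), le_div_iff₀ hn]
    linarith
  rcases le_or_gt 6 ε with h6 | h6
  · exact quadratic_lt_sq_of_six_le h6 hu.le (Real.sqrt_nonneg _) huv (Real.sqrt_nonneg _)
      (by positivity)
  · refine quadratic_lt_sq_of_lt_six hε h6 hu.le (Real.sqrt_nonneg _) huv (Real.sqrt_nonneg _)
      ?_ ?_
    · rw [Real.sq_sqrt (by positivity), le_div_iff₀ hn]
      linarith
    · rw [le_div_iff₀ hn]
      have : 1000 ≤ n * ε := by nlinarith [mul_pos hn hε]
      linarith

lemma sq_sqrt_condExpGt_le {t : ℝ} (ht : 0 ≤ t) : √(condExpGt t) ^ 2 ≤ t + 2 := by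
  rcases le_total 0 (condExpGt t) with h | h
  · rw [Real.sq_sqrt h]
    exact condExpGt_le ht
  · rw [Real.sqrt_eq_zero_of_nonpos h]
    linarith

lemma sparsity_parameters {N s : ℕ} {t : ℝ} (hs : 0 < s) (hsN : (s : ℝ) / N < 1 / 5)
    (ht : chiSq1 (Set.Ioi t) = ENNReal.ofReal (((s : ℝ) - 1) / ((N : ℝ) - 1))) :
    ∃ k M : ℕ, s = k + 1 ∧ N = M + 1 ∧ 0 < k ∧ 5 * k < M ∧
      chiSq1 (Set.Ioi t) = ENNReal.ofReal ((k : ℝ) / M) := by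
  have hpos := chiSq1_Ioi_pos t
  rw [ht, ENNReal.ofReal_pos] at hpos
  obtain ⟨k, rfl⟩ := Nat.exists_eq_succ_of_ne_zero hs.ne'
  rcases N with _ | M
  · push_cast at hpos
    have : (0 : ℝ) ≤ k := k.cast_nonneg
    norm_num at hpos
    linarith
  · push_cast at hpos ht hsN
    simp only [add_sub_cancel_right] at hpos ht
    refine ⟨k, M, rfl, rfl, ?_, ?_, ht⟩
    · rcases k.eq_zero_or_pos with rfl | h
      · simp at hpos
      · exact h
    · rw [div_lt_div_iff₀ (by positivity) (by norm_num)] at hsN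
      have : 5 * (k : ℝ) < M := by linarith
      exact_mod_cast this

lemma gaussianMatrix_ripPlus_of_lt_div_ten {n M s : ℕ} {ε u : ℝ} (hn : 0 < n) (hs : 1 ≤ s)
    (hε : 0 < ε) (hu : 0 ≤ u) (h : u < ε / 10) :
    ENNReal.ofReal (1 - Real.exp (-(n * ε ^ 2) / 4000000)) ≤
      gaussianMatrixMeasure n (M + 1)
        {A | √((1 + u) * (1 - ε) + u ^ 2 / 2) - 1 ≤
          ripPlus n (M + 1) s fun i j => A i j / √n} := by
  have hw := single_mem_sparseUnitVecs (M := M) hs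
  have hn' : (0 : ℝ) < n := by exact_mod_cast hn
  refine ofReal_one_sub_le_gaussianMatrixMeasure (Real.exp_pos _).le
    ((gaussianMatrix_sum_sq_le (n := n) (η := ε / 1000) (by positivity) le_rfl hw.1).trans
      (ENNReal.ofReal_le_ofReal (Real.exp_le_exp.2 ?_))) fun A hA => ?_
  · linarith
  · simp only [Set.mem_ofPred_eq, not_le] at hA ⊢
    rcases quadratic_le_of_lt_div_ten hε hu h with hQ | ⟨hη, hQ⟩
    · rw [Real.sqrt_eq_zero_of_nonpos hQ, zero_sub]
      exact neg_one_le_ripPlus _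
    · refine le_trans (sub_le_sub_right ?_ 1) (normSqMulVec_sub_one_le_ripPlus _ hw)
      rw [normSqMulVec_div]
      refine (Real.sqrt_le_left hη |>.2 hQ).trans ?_
      rw [le_div_iff₀ hn']
      linarith

lemma gaussianMatrix_ripPlus_of_div_ten_le {m M k : ℕ} {ε u t : ℝ} (hk : 0 < k) (hM : 5 * k < M)
    (ht : chiSq1 (Set.Ioi t) = ENNReal.ofReal ((k : ℝ) / M)) (hε : 0 < ε)
    (hnε : 6000 ≤ (m + 1 : ℕ) * ε ^ 2) (hut : (m + 1 : ℕ) * u ^ 2 ≤ (k + 1) * (t + 2))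
    (h : ε / 10 ≤ u) :
    ENNReal.ofReal (1 - 5 * Real.exp (-((m + 1 : ℕ) * ε ^ 2) / 4000000)) ≤
      gaussianMatrixMeasure (m + 1) (M + 1)
        {A | √((1 + u) * (1 - ε) + u ^ 2 / 2) - 1 ≤
          ripPlus (m + 1) (M + 1) (k + 1) fun i j => A i j / √(m + 1 : ℕ)} := by
  obtain ⟨-, θ, hθ, hkθ, hcard⟩ := exists_threshold hk hM ht
  set n : ℝ := ((m + 1 : ℕ) : ℝ) with hn
  have hn0 : 0 < n := by positivity
  have hm : (m : ℝ) = n - 1 := by rw [hn]; push_cast; ring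
  have hu : 0 < u := lt_of_lt_of_le (by positivity) h
  have hexp : Real.exp (-((k + 1) * (t + 2) / 9600)) ≤ Real.exp (-(n * ε ^ 2) / 4000000) := by
    have h1 : n * (ε / 10) ^ 2 ≤ n * u ^ 2 := by gcongr
    refine Real.exp_le_exp.2 ?_
    linarith
  have hexp' : Real.exp (-(n * (ε / 1000) ^ 2 / 4)) = Real.exp (-(n * ε ^ 2) / 4000000) := by
    congr 1
    ring
  have hbad := gaussianMatrix_forall_sparse_cons_le (m := m) (M := M) (n := n) hk hθ
    (η := ε / 1000) (c := 2 * n * √((1 + u) * (1 - ε) + u ^ 2 / 2)) (by positivity) le_rfl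
    fun r y hr hr' hy hy' => two_mul_sqrt_quadratic_lt hn0 hε hnε hu (by linarith) hr hr' hy
      (by rwa [hm] at hy')
  refine ofReal_one_sub_le_gaussianMatrixMeasure (by positivity)
    (hbad.trans ((add_le_add_right (add_le_add_left hcard _) _).trans ?_)) fun A hA => ?_
  · rw [← ENNReal.ofReal_add (by positivity) (by positivity),
      ← ENNReal.ofReal_add (by positivity) (by positivity), hexp']
    exact ENNReal.ofReal_le_ofReal (by linarith)
  · simp only [Set.mem_ofPred_eq, not_forall, not_le] at hA ⊢
    obtain ⟨w, hw, hlt⟩ := hA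
    refine le_trans (sub_le_sub_right ?_ 1)
      (normSqMulVec_sub_one_le_ripPlus _ (cons_mem_sparseUnitVecs hw))
    rw [normSqMulVec_div_cons, le_div_iff₀ (by positivity)]
    linarith

/-- **Theorem 1 (lower bound for `δ_s^+`).**  There is a constant `C > 0` such that for a Gaussian
`n × N` random matrix `A`, sparsity `s` with `s/N < 1/5`, `Φ = A/√n`, `p = s/n`,
`δ = ε + (n log(N/s))^{-1/2}`, `t` the `(1 - (s-1)/(N-1))`-quantile of `Y ~ χ²₁` and
`T = √(E(Y | Y > t))`, with probability at least `1 - C e^{-nε²/C}` we have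
`δ_s^+(Φ) ≥ ((1 + √p T)(1 - δ) + ½ p T²)^{1/2} − 1`. -/
theorem ripPlus_lower_bound :
    ∃ C : ℝ, 0 < C ∧
      ∀ (n N s : ℕ) (ε t T : ℝ), 0 < n → 0 < s → (s : ℝ) / N < 1 / 5 → 0 < ε →
        chiSq1 (Set.Ioi t) = ENNReal.ofReal (((s : ℝ) - 1) / ((N : ℝ) - 1)) →
        T = Real.sqrt (condExpGt t) →
        ENNReal.ofReal (1 - C * Real.exp (-(n * ε ^ 2) / C)) ≤
          gaussianMatrixMeasure n N
            {A | Real.sqrt ((1 + Real.sqrt ((s : ℝ) / n) * T) *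
                    (1 - (ε + 1 / Real.sqrt (n * Real.log ((N : ℝ) / s)))) +
                    (1 / 2) * ((s : ℝ) / n) * T ^ 2) - 1 ≤
                  ripPlus n N s (fun i j => A i j / Real.sqrt n)} := by
  refine ⟨4000000, by norm_num, fun n N s ε t T hn hs hsN hε ht hT => ?_⟩
  obtain ⟨k, M, rfl, rfl, hk, hM, ht'⟩ := sparsity_parameters hs hsN ht
  obtain ⟨m, rfl⟩ := Nat.exists_eq_succ_of_ne_zero hn.ne'
  rw [Nat.succ_eq_add_one]
  rcases lt_or_ge ((m + 1 : ℕ) * ε ^ 2) 6000 with hnε | hnε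
  · rw [ENNReal.ofReal_of_nonpos (by linarith [exp_tail_ge_one hnε])]
    exact zero_le
  set u : ℝ := √((k + 1 : ℕ) / (m + 1 : ℕ)) * T with hu
  have hT0 : 0 ≤ T := hT ▸ Real.sqrt_nonneg _
  have hu0 : 0 ≤ u := by positivity
  have hu2 : u ^ 2 = (k + 1 : ℕ) / (m + 1 : ℕ) * T ^ 2 := by
    rw [hu, mul_pow, Real.sq_sqrt (by positivity)]
  have ht1 := (exists_threshold hk hM ht').1
  have hut : (m + 1 : ℕ) * u ^ 2 ≤ (k + 1) * (t + 2) := by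
    rw [hu2, ← mul_assoc, mul_div_cancel₀ _ (by positivity), hT]
    push_cast
    gcongr
    exact sq_sqrt_condExpGt_le (by linarith)
  have hE := Real.exp_pos (-((m + 1 : ℕ) * ε ^ 2) / 4000000)
  have hQ : ENNReal.ofReal
      (1 - 4000000 * Real.exp (-((m + 1 : ℕ) * ε ^ 2) / 4000000)) ≤
      gaussianMatrixMeasure (m + 1) (M + 1)
        {A | √((1 + u) * (1 - ε) + u ^ 2 / 2) - 1 ≤
          ripPlus (m + 1) (M + 1) (k + 1) fun i j => A i j / √(m + 1 : ℕ)} := by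
    rcases lt_or_ge u (ε / 10) with h | h
    · exact (ENNReal.ofReal_le_ofReal (by linarith)).trans
        (gaussianMatrix_ripPlus_of_lt_div_ten (Nat.succ_pos m) (Nat.succ_pos k) hε hu0 h)
    · exact (ENNReal.ofReal_le_ofReal (by linarith)).trans
        (gaussianMatrix_ripPlus_of_div_ten_le hk hM ht' hε hnε hut h)
  refine hQ.trans (measure_mono fun A hA => ?_)
  refine le_trans (sub_le_sub_right (Real.sqrt_le_sqrt ?_) 1) hA
  rw [mul_assoc, ← hu2]
  have hδ : 0 ≤ 1 / √((m + 1 : ℕ) * Real.log ((M + 1 : ℕ) / (k + 1 : ℕ))) := by positivity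
  nlinarith [mul_nonneg hu0 hδ]
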